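/- Let (B, d) be a metric space. The structure A = ℕ⁺ × B, p(n, x) = x, s(x) = (1, x), m((n, x), (n', x)) = (n·n', x), (n, x) R y ↔ d(x, y) < 1/n, and ∂((n, x), y) = (k, y) for any natural k > n/(1 − n·d(x, y)), is a spatial fibrous preorder (satisfies (F1)–(F6)). -/

import Mathlib

theorem one_div_lt_one_div_sub_of_div_lt {n k d : ℝ} (hn : 0 < n) (hd : d < 1 / n)
    (hk : n / (1 - n * d) < k) : 1 / k < 1 / n - d := by
  have hpos : 0 < 1 - n * d := by
    rw [lt_div_iff₀ hn] at hd
    linarith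
  calc 1 / k < 1 / (n / (1 - n * d)) := one_div_lt_one_div_of_lt (div_pos hn hpos) hk
    _ = 1 / n - d := by field_simp

theorem one_div_mul_le_one_div_left (a b : ℕ+) :
    1 / ((a * b : ℕ+) : ℝ) ≤ 1 / (a : ℝ) := by
  have ha : (0 : ℝ) < a := by exact_mod_cast a.pos
  have hb : (1 : ℝ) ≤ b := by exact_mod_cast b.pos
  rw [PNat.mul_coe, Nat.cast_mul]
  exact one_div_le_one_div_of_le ha (le_mul_of_one_le_right ha.le hb)


/-- For a metric space `(B, d)`, the structure `A = ℕ⁺ × B`,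
`p(n,x) = x`, `s(x) = (1,x)`, `m((n,x),(n',x)) = (n·n', x)`,
`(n,x) R y ↔ d(x,y) < 1/n`, and `∂((n,x), y) = (k, y)` for any `k` with
`(k : ℝ) > n / (1 - n·d(x,y))`, is a spatial fibrous preorder. -/
theorem metric_spatial_fibrous_preorder (B : Type*) [MetricSpace B]
    (p : ℕ+ × B → B) (hp : ∀ a, p a = a.2)
    (R : ℕ+ × B → B → Prop)
    (hR : ∀ a y, R a y ↔ dist a.2 y < 1 / (a.1 : ℝ))
    (s : B → ℕ+ × B) (hs : ∀ x, s x = (1, x))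
    (m : ℕ+ × B → ℕ+ × B → ℕ+ × B)
    (hm : ∀ a a', a.2 = a'.2 → m a a' = (a.1 * a'.1, a.2))
    (bd : ℕ+ × B → B → ℕ+ × B)
    (hbd1 : ∀ a y, R a y → (bd a y).2 = y)
    (hbd2 : ∀ a y, R a y →
      ((bd a y).1 : ℝ) > (a.1 : ℝ) / (1 - (a.1 : ℝ) * dist a.2 y)) :
    (∀ a b, R a b → p (bd a b) = b) ∧
    (∀ a, R a (p a)) ∧
    (∀ a b y, R a b → R (bd a b) y → R a y) ∧
    (∀ y, p (s y) = y) ∧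
    (∀ a a', p a = p a' → p (m a a') = p a ∧ p (m a a') = p a') ∧
    (∀ a a' y, p a = p a' → R (m a a') y → R a y ∧ R a' y) := by
  have pos (n : ℕ+) : (0 : ℝ) < n := by exact_mod_cast n.pos
  refine ⟨fun a b h => by rw [hp, hbd1 a b h], fun a => ?_, fun a b y hab hby => ?_,
    fun y => by rw [hp, hs], fun a a' h => ?_, fun a a' y h hy => ?_⟩
  · rw [hR, hp, dist_self]
    exact one_div_pos.mpr (pos a.1)
  · have hk := one_div_lt_one_div_sub_of_div_lt (pos a.1) ((hR a b).mp hab) (hbd2 a b hab)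
    rw [hR, hbd1 a b hab] at hby
    rw [hR]
    linarith [dist_triangle a.2 b y]
  · simp only [hp] at h ⊢
    rw [hm a a' h]
    exact ⟨rfl, h⟩
  · simp only [hp] at h
    rw [hR, hm a a' h] at hy
    rw [hR, hR, ← h]
    refine ⟨hy.trans_le (one_div_mul_le_one_div_left a.1 a'.1), hy.trans_le ?_⟩
    rw [mul_comm a.1 a'.1]
    exact one_div_mul_le_one_div_left a'.1 a.1
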